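/- (Proposition 1, inequality (17)) Let d ≥ 2, n = d+1, and fix nonnegative integers ℓ₁, ℓ₂ with ℓ := ℓ₁+ℓ₂ < d. For any symmetrical code that satisfies node regeneration, message recovery (for parameter ℓ), and repair secrecy (for parameters ℓ₁, ℓ₂), one has (1/(d−ℓ)) · H(U^{(ℓ₁,ℓ+1)}) ≥ Σ_{j=ℓ+1}^{d} T_{d,j,ℓ}^{−1} B_j + (1/(d−ℓ)) · H(U^{(ℓ₁,ℓ)}). -/

import Mathlib

open scoped BigOperators Classical

namespace MDCSR

noncomputable section

/-- `X` is a deterministic function of `Y`. -/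
def IsFuncOf {Ω α β : Type*} (X : Ω → α) (Y : Ω → β) : Prop :=
  ∃ f : β → α, ∀ ω, X ω = f (Y ω)

variable {Ω V : Type} [Fintype Ω]

/-- Probability of the event `X = x` under the probability mass function `p`. -/
def pm (p : Ω → ℝ) {α : Type*} (X : Ω → α) (x : α) : ℝ :=
  ∑ ω ∈ Finset.univ.filter (fun ω' => X ω' = x), p ω

/-- Shannon entropy of the random variable `X` under the probability mass function `p`. -/
def H (p : Ω → ℝ) {α : Type*} (X : Ω → α) : ℝ :=
  -∑ ω, p ω * Real.log (pm p X (X ω))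

/-- An `(n = d+1, d)` code: messages `M 1, …, M d`, a key `K`, node contents
`W 1, …, W (d+1)`, and repair data `S i j` (data downloaded from node `i` to repair
node `j`), all random variables on a common finite probability space `(Ω, p)`.
The messages are mutually independent, the key is independent of the messages,
each `W i` is a deterministic function of the messages and the key, and each
`S i j` is a deterministic function of `W i`. -/
structure Code (Ω V : Type) [Fintype Ω] (d : ℕ) : Type where
  p : Ω → ℝ
  p_nonneg : ∀ ω, 0 ≤ p ω
  p_sum : ∑ ω, p ω = 1
  M : ℕ → Ω → V
  K : Ω → V
  W : ℕ → Ω → V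
  S : ℕ → ℕ → Ω → V
  M_indep : ∀ x : ℕ → V,
    pm p (fun ω (i : Fin d) => M (↑i + 1) ω) (fun i => x (↑i + 1)) =
      ∏ i ∈ Finset.Icc 1 d, pm p (M i) (x i)
  K_indep : ∀ (k : V) (x : ℕ → V),
    pm p (fun ω => (K ω, fun (i : Fin d) => M (↑i + 1) ω)) (k, fun i => x (↑i + 1)) =
      pm p K k * pm p (fun ω (i : Fin d) => M (↑i + 1) ω) (fun i => x (↑i + 1))
  W_func : ∀ i ∈ Finset.Icc 1 (d + 1),
    IsFuncOf (W i) (fun ω => ((fun (j : Fin d) => M (↑j + 1) ω), K ω))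
  S_func : ∀ i ∈ Finset.Icc 1 (d + 1), ∀ j ∈ Finset.Icc 1 (d + 1), i ≠ j →
    IsFuncOf (S i j) (W i)

/-- Descriptors for the basic random variables of a code. -/
inductive Atom where
  | M : ℕ → Atom
  | K : Atom
  | W : ℕ → Atom
  | S : ℕ → ℕ → Atom

variable {d : ℕ}

/-- The random variable described by an atom. -/
def Code.atomRV (C : Code Ω V d) : Atom → Ω → V
  | .M i => C.M i
  | .K => C.K
  | .W i => C.W i
  | .S i j => C.S i j

/-- The joint random variable (tuple) described by a list of atoms. -/
def Code.rv (C : Code Ω V d) (L : List Atom) : Ω → List V :=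
  fun ω => L.map fun a => C.atomRV a ω

/-- Joint entropy of a tuple of basic random variables. -/
def Code.HL (C : Code Ω V d) (L : List Atom) : ℝ := H C.p (C.rv L)

/-- Conditional entropy `H(L₁ | L₂)`. -/
def Code.CH (C : Code Ω V d) (L₁ L₂ : List Atom) : ℝ := C.HL (L₁ ++ L₂) - C.HL L₂

/-- Mutual information `I(L₁ ; L₂)`. -/
def Code.MI (C : Code Ω V d) (L₁ L₂ : List Atom) : ℝ :=
  C.HL L₁ + C.HL L₂ - C.HL (L₁ ++ L₂)

/-- Relabeling of an atom along a permutation of the storage-node indices. -/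
def Atom.perm (π : Equiv.Perm ℕ) : Atom → Atom
  | .M i => .M i
  | .K => .K
  | .W i => .W (π i)
  | .S i j => .S (π i) (π j)

/-- A code is symmetrical if every joint entropy of a tuple of the basic random
variables is invariant under every permutation of the storage-node indices `[1:n]`. -/
def Code.Symmetrical (C : Code Ω V d) : Prop :=
  ∀ π : Equiv.Perm ℕ, (∀ i ∈ Finset.Icc 1 (d + 1), π i ∈ Finset.Icc 1 (d + 1)) →
    ∀ L : List Atom, C.HL (L.map (Atom.perm π)) = C.HL L

/-- The list `[a, a+1, …, b]`. -/
def icc (a b : ℕ) : List ℕ := List.range' a (b + 1 - a)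

/-- `W_A` as a list of atoms. -/
def Ws (A : List ℕ) : List Atom := A.map Atom.W

/-- `M_A` as a list of atoms. -/
def MsL (A : List ℕ) : List Atom := A.map Atom.M

/-- `M^{(m)} = (M_1, …, M_m)`. -/
def Mup (m : ℕ) : List Atom := MsL (icc 1 m)

/-- `S_{B → j}`. -/
def Sto (B : List ℕ) (j : ℕ) : List Atom := B.map fun i => Atom.S i j

/-- `S_{i → B}`. -/
def Sfrom (i : ℕ) (B : List ℕ) : List Atom := B.map fun j => Atom.S i j

/-- `S̄_{→ j} = S_{[j+1:n] → j}` (here `n = d+1`). -/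
def SbarTo (d j : ℕ) : List Atom := Sto (icc (j + 1) (d + 1)) j

/-- `S̄_{→ A}`. -/
def SbarToL (d : ℕ) (A : List ℕ) : List Atom := (A.map (SbarTo d)).flatten

/-- `S̲_{→ j} = S_{[1:j-1] → j}`. -/
def SunderTo (j : ℕ) : List Atom := Sto (icc 1 (j - 1)) j

/-- `S̲_{→ A}`. -/
def SunderToL (A : List ℕ) : List Atom := (A.map SunderTo).flatten

/-- `S_{→ j} = S_{([1:n] ∖ {j}) → j}` (here `n = d+1`). -/
def StoFull (d j : ℕ) : List Atom := Sto ((icc 1 (d + 1)).filter (fun i => i ≠ j)) j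

/-- `(S_{→ j} : j ∈ A)`. -/
def StoFullL (d : ℕ) (A : List ℕ) : List Atom := (A.map (StoFull d)).flatten

/-- `U^{(t,s)} = (W_{[1:t]}, S̄_{→[t+1:s]})`. -/
def U (d t s : ℕ) : List Atom := Ws (icc 1 t) ++ SbarToL d (icc (t + 1) s)

/-- Node regeneration: each `W j` is a deterministic function of `S_{→ j}`. -/
def Code.NodeRegen (C : Code Ω V d) : Prop :=
  ∀ j ∈ Finset.Icc 1 (d + 1), IsFuncOf (C.W j) (C.rv (StoFull d j))

/-- Message recovery for parameter `ℓ`: `M j` is constant for `j ∈ [1:ℓ]`, and for every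
`A ⊆ [1:n]` with `|A| ∈ [ℓ+1:d]`, `M_{|A|}` is a deterministic function of `W_A`. -/
def Code.MsgRecovery (C : Code Ω V d) (ℓ : ℕ) : Prop :=
  (∀ j ∈ Finset.Icc 1 ℓ, ∃ c : V, ∀ ω, C.M j ω = c) ∧
  ∀ A : Finset ℕ, A ⊆ Finset.Icc 1 (d + 1) → A.card ∈ Finset.Icc (ℓ + 1) d →
    IsFuncOf (C.M A.card) (C.rv (Ws (A.sort (· ≤ ·))))

/-- Repair secrecy for parameters `ℓ₁, ℓ₂`: for all disjoint `E₁, E₂ ⊆ [1:n]` with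
`|E₁| = ℓ₁`, `|E₂| = ℓ₂`, the messages `M_{ℓ+1}, …, M_d` are independent of
`((W_i : i ∈ E₁), (S_{→j} : j ∈ E₂))`, where `ℓ = ℓ₁ + ℓ₂`. -/
def Code.RepairSecrecy (C : Code Ω V d) (ℓ₁ ℓ₂ : ℕ) : Prop :=
  ∀ E₁ E₂ : Finset ℕ, E₁ ⊆ Finset.Icc 1 (d + 1) → E₂ ⊆ Finset.Icc 1 (d + 1) →
    Disjoint E₁ E₂ → E₁.card = ℓ₁ → E₂.card = ℓ₂ →
    C.MI (MsL (icc (ℓ₁ + ℓ₂ + 1) d))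
      (Ws (E₁.sort (· ≤ ·)) ++ StoFullL d (E₂.sort (· ≤ ·))) = 0

/-- `T_{d,k,ℓ} = Σ_{t=ℓ+1}^{k} (d+1−t)`, as a real number. -/
def T (d k ℓ : ℕ) : ℝ := ∑ t ∈ Finset.Icc (ℓ + 1) k, ((d : ℝ) + 1 - (t : ℝ))


section Entropy

variable {p : Ω → ℝ} {α β γ : Type*}

lemma pm_nonneg (hp : ∀ ω, 0 ≤ p ω) (X : Ω → α) (x : α) : 0 ≤ pm p X x :=
  Finset.sum_nonneg fun ω _ => hp ω

lemma le_pm_self (hp : ∀ ω, 0 ≤ p ω) (X : Ω → α) (ω : Ω) : p ω ≤ pm p X (X ω) :=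
  Finset.single_le_sum (f := p) (fun ω _ => hp ω) (by simp)

/-- If `Y` determines `X` then `{Y = Y ω} ⊆ {X = X ω}`. -/
lemma pm_le_pm_of_determines (hp : ∀ ω, 0 ≤ p ω) {X : Ω → α} {Y : Ω → β}
    (h : ∀ ω ω', Y ω = Y ω' → X ω = X ω') (ω : Ω) : pm p Y (Y ω) ≤ pm p X (X ω) := by
  refine Finset.sum_le_sum_of_subset_of_nonneg (fun ω' hω => ?_) fun ω _ _ => hp ω
  simp only [Finset.mem_filter, Finset.mem_univ, true_and] at hω ⊢
  exact h _ _ hω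

/-- Entropy is monotone under taking deterministic functions. -/
lemma H_mono (hp : ∀ ω, 0 ≤ p ω) {X : Ω → α} {Y : Ω → β}
    (h : ∀ ω ω', Y ω = Y ω' → X ω = X ω') : H p X ≤ H p Y := by
  unfold H
  refine neg_le_neg (Finset.sum_le_sum fun ω _ => ?_)
  rcases (hp ω).eq_or_lt with h0 | h0
  · simp [← h0]
  · exact mul_le_mul_of_nonneg_left
      (Real.log_le_log (h0.trans_le (le_pm_self hp Y ω)) (pm_le_pm_of_determines hp h ω)) h0.le

lemma sum_ratio_le_one (hp : ∀ ω, 0 ≤ p ω) (h1 : ∑ ω, p ω = 1)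
    {X : Ω → α} {Y : Ω → β} {Z : Ω → γ}
    (hX : ∀ ω ω', X ω = X ω' → Z ω = Z ω') (hY : ∀ ω ω', Y ω = Y ω' → Z ω = Z ω') :
    ∑ ω, p ω * (pm p X (X ω) * pm p Y (Y ω) /
      (pm p (fun ω => (X ω, Y ω)) (X ω, Y ω) * pm p Z (Z ω))) ≤ 1 := by
  set J : Ω → α × β := fun ω => (X ω, Y ω) with hJ
  have inner : ∀ ω₁ ω₂, ∑ ω, (if X ω₁ = X ω ∧ Y ω₂ = Y ω then
      p ω / (pm p J (J ω) * pm p Z (Z ω)) else 0) ≤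
      if Z ω₂ = Z ω₁ then (pm p Z (Z ω₁))⁻¹ else 0 := by
    intro ω₁ ω₂
    have hz := inv_nonneg.mpr (pm_nonneg hp Z (Z ω₁))
    by_cases hex : ∃ ω, X ω₁ = X ω ∧ Y ω₂ = Y ω
    · obtain ⟨ω₀, hx0, hy0⟩ := hex
      rw [if_pos ((hY _ _ hy0).trans (hX _ _ hx0).symm)]
      have key : ∀ ω, (if X ω₁ = X ω ∧ Y ω₂ = Y ω then
          p ω / (pm p J (J ω) * pm p Z (Z ω)) else 0) =
          (if J ω = J ω₀ then p ω else 0) * ((pm p J (J ω₀))⁻¹ * (pm p Z (Z ω₁))⁻¹) := by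
        intro ω
        by_cases hc : X ω₁ = X ω ∧ Y ω₂ = Y ω
        · have hJe : J ω = J ω₀ := by
            simp only [hJ, Prod.mk.injEq]
            exact ⟨hc.1.symm.trans hx0, hc.2.symm.trans hy0⟩
          rw [if_pos hc, if_pos hJe, hJe, ← hX _ _ hc.1, div_eq_mul_inv, mul_inv]
        · have hJe : ¬ J ω = J ω₀ := by
            simp only [hJ, Prod.mk.injEq]
            exact fun h => hc ⟨hx0.trans h.1.symm, hy0.trans h.2.symm⟩
          rw [if_neg hc, if_neg hJe, zero_mul]
      have hJs : (∑ ω, if J ω = J ω₀ then p ω else 0) = pm p J (J ω₀) := by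
        rw [pm, Finset.sum_filter]
        congr!
      rw [Finset.sum_congr rfl fun ω _ => key ω, ← Finset.sum_mul, hJs, ← mul_assoc]
      exact mul_le_of_le_one_left hz mul_inv_le_one
    · push Not at hex
      rw [Finset.sum_eq_zero fun ω _ => if_neg fun h => hex ω h.1 h.2]
      split_ifs
      exacts [hz, le_rfl]
  calc ∑ ω, p ω * (pm p X (X ω) * pm p Y (Y ω) / (pm p J (J ω) * pm p Z (Z ω)))
      = ∑ ω, ∑ ω₁, ∑ ω₂, p ω₁ * p ω₂ * (if X ω₁ = X ω ∧ Y ω₂ = Y ω then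
          p ω / (pm p J (J ω) * pm p Z (Z ω)) else 0) := by
        refine Finset.sum_congr rfl fun ω _ => ?_
        have hXs : pm p X (X ω) = ∑ ω₁, if X ω₁ = X ω then p ω₁ else 0 := Finset.sum_filter _ _
        have hYs : pm p Y (Y ω) = ∑ ω₂, if Y ω₂ = Y ω then p ω₂ else 0 := Finset.sum_filter _ _
        rw [mul_div_left_comm, hXs, hYs, Finset.sum_mul_sum, Finset.sum_mul]
        refine Finset.sum_congr rfl fun ω₁ _ => ?_
        rw [Finset.sum_mul]
        refine Finset.sum_congr rfl fun ω₂ _ => ?_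
        by_cases h₁ : X ω₁ = X ω <;> by_cases h₂ : Y ω₂ = Y ω <;> simp [h₁, h₂]
    _ = ∑ ω₁, ∑ ω₂, p ω₁ * p ω₂ * ∑ ω, (if X ω₁ = X ω ∧ Y ω₂ = Y ω then
          p ω / (pm p J (J ω) * pm p Z (Z ω)) else 0) := by
        rw [Finset.sum_comm]
        refine Finset.sum_congr rfl fun ω₁ _ => ?_
        rw [Finset.sum_comm]
        exact Finset.sum_congr rfl fun ω₂ _ => (Finset.mul_sum _ _ _).symm
    _ ≤ ∑ ω₁, ∑ ω₂, p ω₁ * p ω₂ * (if Z ω₂ = Z ω₁ then (pm p Z (Z ω₁))⁻¹ else 0) :=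
        Finset.sum_le_sum fun ω₁ _ => Finset.sum_le_sum fun ω₂ _ =>
          mul_le_mul_of_nonneg_left (inner ω₁ ω₂) (mul_nonneg (hp _) (hp _))
    _ = ∑ ω₁, p ω₁ * (pm p Z (Z ω₁) * (pm p Z (Z ω₁))⁻¹) := by
        refine Finset.sum_congr rfl fun ω₁ _ => ?_
        have hZs : pm p Z (Z ω₁) = ∑ ω₂, if Z ω₂ = Z ω₁ then p ω₂ else 0 := Finset.sum_filter _ _
        rw [← mul_assoc, hZs, Finset.mul_sum, Finset.sum_mul]
        refine Finset.sum_congr rfl fun ω₂ _ => ?_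
        split_ifs <;> simp
    _ ≤ ∑ ω₁, p ω₁ := Finset.sum_le_sum fun ω₁ _ =>
        mul_le_of_le_one_right (hp _) mul_inv_le_one
    _ = 1 := h1

/-- Submodularity of entropy. -/
lemma H_prod_add_H_le (hp : ∀ ω, 0 ≤ p ω) (h1 : ∑ ω, p ω = 1)
    {X : Ω → α} {Y : Ω → β} {Z : Ω → γ}
    (hX : ∀ ω ω', X ω = X ω' → Z ω = Z ω') (hY : ∀ ω ω', Y ω = Y ω' → Z ω = Z ω') :
    H p (fun ω => (X ω, Y ω)) + H p Z ≤ H p X + H p Y := by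
  have hterm : ∀ ω, p ω * Real.log (pm p X (X ω)) + p ω * Real.log (pm p Y (Y ω)) ≤
      p ω * Real.log (pm p (fun ω => (X ω, Y ω)) (X ω, Y ω)) + p ω * Real.log (pm p Z (Z ω)) +
      (p ω * (pm p X (X ω) * pm p Y (Y ω) /
      (pm p (fun ω => (X ω, Y ω)) (X ω, Y ω) * pm p Z (Z ω))) - p ω) := by
    intro ω
    rcases (hp ω).eq_or_lt with h0 | h0
    · simp [← h0]
    have a := h0.trans_le (le_pm_self hp X ω)
    have b := h0.trans_le (le_pm_self hp Y ω)
    have c := h0.trans_le (le_pm_self hp (fun ω => (X ω, Y ω)) ω)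
    have e := h0.trans_le (le_pm_self hp Z ω)
    have hlog := Real.log_le_sub_one_of_pos (div_pos (mul_pos a b) (mul_pos c e))
    rw [Real.log_div (mul_pos a b).ne' (mul_pos c e).ne', Real.log_mul a.ne' b.ne',
      Real.log_mul c.ne' e.ne'] at hlog
    linarith [mul_le_mul_of_nonneg_left hlog h0.le]
  have hs := Finset.sum_le_sum fun ω (_ : ω ∈ Finset.univ) => hterm ω
  simp only [Finset.sum_add_distrib, Finset.sum_sub_distrib] at hs
  have := sum_ratio_le_one hp h1 hX hY
  unfold H
  linarith

end Entropy

namespace Code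

variable (C : Code Ω V d)

/-- The tuple `Y` determines the tuple `X`. -/
def Det (Y X : List Atom) : Prop :=
  ∀ ω ω', (∀ a ∈ Y, C.atomRV a ω = C.atomRV a ω') → ∀ a ∈ X, C.atomRV a ω = C.atomRV a ω'

variable {C}

lemma rv_eq_iff {L : List Atom} {ω ω' : Ω} :
    C.rv L ω = C.rv L ω' ↔ ∀ a ∈ L, C.atomRV a ω = C.atomRV a ω' := by
  simp [rv]

lemma det_of_subset {X Y : List Atom} (h : X ⊆ Y) : C.Det Y X :=
  fun _ _ hY a ha => hY a (h ha)

lemma Det.append {X Y Z : List Atom} (hX : C.Det Z X) (hY : C.Det Z Y) : C.Det Z (X ++ Y) := by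
  intro ω ω' h a ha
  rcases List.mem_append.mp ha with ha | ha
  exacts [hX ω ω' h a ha, hY ω ω' h a ha]

lemma Det.trans {X Y Z : List Atom} (h : C.Det X Y) (h' : C.Det Y Z) : C.Det X Z :=
  fun ω ω' hX => h' ω ω' (h ω ω' hX)

lemma Det.HL_le {X Y : List Atom} (h : C.Det Y X) : C.HL X ≤ C.HL Y :=
  H_mono C.p_nonneg fun ω ω' hY => rv_eq_iff.mpr (h ω ω' (rv_eq_iff.mp hY))

lemma HL_congr {X Y : List Atom} (h : ∀ a, a ∈ X ↔ a ∈ Y) : C.HL X = C.HL Y :=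
  le_antisymm (det_of_subset fun a => (h a).mp).HL_le (det_of_subset fun a => (h a).mpr).HL_le

/-- Submodularity of joint entropy. -/
lemma HL_add_HL_le {X Y Z J : List Atom} (hJ : C.Det (X ++ Y) J)
    (hX : C.Det X Z) (hY : C.Det Y Z) : C.HL J + C.HL Z ≤ C.HL X + C.HL Y := by
  have h₁ : C.HL J ≤ H C.p (fun ω => (C.rv X ω, C.rv Y ω)) := by
    refine H_mono C.p_nonneg fun ω ω' h => rv_eq_iff.mpr (hJ ω ω' fun a ha => ?_)
    rw [Prod.mk.injEq, rv_eq_iff, rv_eq_iff] at h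
    rcases List.mem_append.mp ha with ha | ha
    exacts [h.1 a ha, h.2 a ha]
  have h₂ := H_prod_add_H_le (X := C.rv X) (Y := C.rv Y) (Z := C.rv Z) C.p_nonneg C.p_sum
    (fun ω ω' h => rv_eq_iff.mpr (hX ω ω' (rv_eq_iff.mp h)))
    (fun ω ω' h => rv_eq_iff.mpr (hY ω ω' (rv_eq_iff.mp h)))
  unfold HL at h₁ ⊢
  linarith

@[simp] lemma HL_nil : C.HL [] = 0 := by
  have : ∀ ω, pm C.p (C.rv []) (C.rv [] ω) = 1 := by
    intro ω
    simp [pm, rv, C.p_sum]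
  simp [HL, H, this]

/-- Subadditivity of joint entropy. -/
lemma HL_append_le (X Y : List Atom) : C.HL (X ++ Y) ≤ C.HL X + C.HL Y := by
  have := HL_add_HL_le (C := C) (X := X) (Y := Y) (Z := []) (det_of_subset fun _ => id)
    (det_of_subset (by simp)) (det_of_subset (by simp))
  simpa using this

end Code

lemma mem_icc {a b i : ℕ} : i ∈ icc a b ↔ a ≤ i ∧ i ≤ b := by
  simp only [icc, List.mem_range'_1]
  omega

lemma mem_U {d t s : ℕ} {a : Atom} : a ∈ U d t s ↔
    (∃ i, (1 ≤ i ∧ i ≤ t) ∧ a = .W i) ∨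
    ∃ j, (t + 1 ≤ j ∧ j ≤ s) ∧ ∃ i, (j + 1 ≤ i ∧ i ≤ d + 1) ∧ a = .S i j := by
  simp only [U, Ws, SbarToL, SbarTo, Sto, List.mem_append, List.mem_map, List.mem_flatten, mem_icc]
  constructor
  · rintro (⟨i, hi, rfl⟩ | ⟨_, ⟨j, hj, rfl⟩, h⟩)
    · exact .inl ⟨i, hi, rfl⟩
    · obtain ⟨i, hi, rfl⟩ := List.mem_map.mp h
      exact .inr ⟨j, hj, i, mem_icc.mp hi, rfl⟩
  · rintro (⟨i, hi, rfl⟩ | ⟨j, hj, i, hi, rfl⟩)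
    · exact .inl ⟨i, hi, rfl⟩
    · exact .inr ⟨_, ⟨j, hj, rfl⟩, List.mem_map.mpr ⟨i, mem_icc.mpr hi, rfl⟩⟩

lemma mem_SbarTo {d j : ℕ} {a : Atom} :
    a ∈ SbarTo d j ↔ ∃ i, (j + 1 ≤ i ∧ i ≤ d + 1) ∧ a = .S i j := by
  simp only [SbarTo, Sto, List.mem_map, mem_icc, eq_comm]

lemma mem_MsL {A : List ℕ} {a : Atom} : a ∈ MsL A ↔ ∃ i ∈ A, a = .M i := by
  simp only [MsL, List.mem_map, eq_comm]

lemma mem_U_succ {d t s : ℕ} (h : t ≤ s) {a : Atom} :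
    a ∈ U d t (s + 1) ↔ a ∈ U d t s ∨ a ∈ SbarTo d (s + 1) := by
  simp only [mem_U, mem_SbarTo]
  constructor
  · rintro (h' | ⟨j, hj, h'⟩)
    · exact .inl (.inl h')
    · rcases Nat.lt_or_ge s j with hs | hs
      · obtain rfl : j = s + 1 := by omega
        exact .inr h'
      · exact .inl (.inr ⟨j, ⟨hj.1, hs⟩, h'⟩)
  · rintro ((h' | ⟨j, hj, h'⟩) | h')
    · exact .inl h'
    · exact .inr ⟨j, ⟨hj.1, by omega⟩, h'⟩
    · exact .inr ⟨s + 1, ⟨by omega, le_rfl⟩, h'⟩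

lemma U_subset_U {d t s s' : ℕ} (h : s ≤ s') : U d t s ⊆ U d t s' := by
  intro a
  simp only [mem_U]
  rintro (h' | ⟨j, hj, h'⟩)
  · exact .inl h'
  · exact .inr ⟨j, ⟨hj.1, hj.2.trans h⟩, h'⟩

lemma Atom.perm_swap_swap (u v : ℕ) (a : Atom) :
    Atom.perm (Equiv.swap u v) (Atom.perm (Equiv.swap u v) a) = a := by
  cases a <;> simp [Atom.perm]

lemma perm_swap_mem_U {d t s u v : ℕ} (hts : t ≤ s) (hu : s < u) (hv : s < v)
    (hud : u ≤ d + 1) (hvd : v ≤ d + 1) {a : Atom} (ha : a ∈ U d t s) :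
    Atom.perm (Equiv.swap u v) a ∈ U d t s := by
  have fix : ∀ i, i ≤ s → Equiv.swap u v i = i := fun i hi =>
    Equiv.swap_apply_of_ne_of_ne (by omega) (by omega)
  rw [mem_U] at ha ⊢
  rcases ha with ⟨i, hi, rfl⟩ | ⟨j, hj, i, hi, rfl⟩
  · exact .inl ⟨i, hi, by simp only [Atom.perm]; rw [fix i (by omega)]⟩
  · refine .inr ⟨j, hj, Equiv.swap u v i, ?_, by simp only [Atom.perm]; rw [fix j hj.2]⟩
    rw [Equiv.swap_apply_def]
    split_ifs <;> omega

namespace Code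

variable {C : Code Ω V d}

/-- Entropies are unchanged by swapping two nodes. -/
lemma Symmetrical.HL_eq_of_swap (hsym : C.Symmetrical) {u v : ℕ}
    (hu : u ∈ Finset.Icc 1 (d + 1)) (hv : v ∈ Finset.Icc 1 (d + 1)) {L L' : List Atom}
    (h : ∀ a ∈ L, Atom.perm (Equiv.swap u v) a ∈ L')
    (h' : ∀ a ∈ L', Atom.perm (Equiv.swap u v) a ∈ L) : C.HL L = C.HL L' := by
  rw [← hsym (Equiv.swap u v) (fun i hi => ?_) L]
  · refine HL_congr fun a => ⟨fun ha => ?_, fun ha => ?_⟩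
    · obtain ⟨b, hb, rfl⟩ := List.mem_map.mp ha
      exact h b hb
    · exact List.mem_map.mpr ⟨_, h' a ha, Atom.perm_swap_swap u v a⟩
  · rw [Equiv.swap_apply_def]
    split_ifs
    exacts [hv, hu, hi]

/-- `U^{(t,s)}` determines `W_{[1:s]}`. -/
lemma NodeRegen.det_U_Ws (hregen : C.NodeRegen) {t s : ℕ} (hs : s ≤ d + 1) :
    C.Det (U d t s) (Ws (icc 1 s)) := by
  intro ω ω' h a ha
  obtain ⟨i, hi, rfl⟩ := List.mem_map.mp ha
  rw [mem_icc] at hi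
  clear ha
  induction i using Nat.strong_induction_on with
  | _ i ih =>
    rcases Nat.lt_or_ge t i with hti | hti
    · obtain ⟨f, hf⟩ := hregen i (Finset.mem_Icc.mpr (by omega))
      have : C.rv (StoFull d i) ω = C.rv (StoFull d i) ω' := by
        refine rv_eq_iff.mpr fun a ha => ?_
        obtain ⟨k, hk, rfl⟩ := List.mem_map.mp ha
        simp only [List.mem_filter, mem_icc, decide_eq_true_eq] at hk
        obtain ⟨⟨hk1, hkd⟩, hki⟩ := hk
        rcases lt_or_gt_of_ne hki with hlt | hgt
        · obtain ⟨g, hg⟩ := C.S_func k (Finset.mem_Icc.mpr (by omega)) i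
            (Finset.mem_Icc.mpr (by omega)) hki
          have hW : C.W k ω = C.W k ω' := ih k hlt (by omega)
          change C.S k i ω = C.S k i ω'
          rw [hg, hg, hW]
        · exact h _ (mem_U.mpr (.inr ⟨i, by omega, k, by omega, rfl⟩))
      change C.W i ω = C.W i ω'
      rw [hf, hf, this]
    · exact h _ (mem_U.mpr (.inl ⟨i, by omega, rfl⟩))

/-- `U^{(t,s)}` determines `S_{i → j}` for `i ≤ s`. -/
lemma NodeRegen.det_U_S (hregen : C.NodeRegen) {t s i j : ℕ} (hs : s ≤ d + 1)
    (hi : 1 ≤ i) (his : i ≤ s) (hj : 1 ≤ j) (hjd : j ≤ d + 1) (hij : i ≠ j) :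
    C.Det (U d t s) [.S i j] := by
  intro ω ω' h a ha
  obtain rfl := List.mem_singleton.mp ha
  have hW : C.W i ω = C.W i ω' :=
    hregen.det_U_Ws hs ω ω' h _ (List.mem_map.mpr ⟨i, mem_icc.mpr ⟨hi, his⟩, rfl⟩)
  obtain ⟨g, hg⟩ := C.S_func i (Finset.mem_Icc.mpr (by omega)) j
    (Finset.mem_Icc.mpr (by omega)) hij
  change C.S i j ω = C.S i j ω'
  rw [hg, hg, hW]

/-- `U^{(t,s)}` determines `M_s`. -/
lemma MsgRecovery.det_U_M {ℓ : ℕ} (hrec : C.MsgRecovery ℓ) (hregen : C.NodeRegen) {t s : ℕ}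
    (hℓs : ℓ < s) (hs : s ≤ d) : C.Det (U d t s) [.M s] := by
  intro ω ω' h a ha
  obtain rfl := List.mem_singleton.mp ha
  obtain ⟨f, hf⟩ := hrec.2 (Finset.Icc 1 s) (Finset.Icc_subset_Icc le_rfl (by omega))
    (by simp; omega)
  rw [Nat.card_Icc, Nat.add_sub_cancel] at hf
  have : C.rv (Ws ((Finset.Icc 1 s).sort (· ≤ ·))) ω =
      C.rv (Ws ((Finset.Icc 1 s).sort (· ≤ ·))) ω' := by
    refine rv_eq_iff.mpr fun a ha => ?_
    obtain ⟨k, hk, rfl⟩ := List.mem_map.mp ha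
    rw [Finset.mem_sort, Finset.mem_Icc] at hk
    exact hregen.det_U_Ws (by omega) ω ω' h _ (List.mem_map.mpr ⟨k, mem_icc.mpr hk, rfl⟩)
  change C.M s ω = C.M s ω'
  rw [hf, hf, this]

lemma HL_append_map_le {X : List Atom} {x : ℝ} (f : ℕ → Atom) (l : List ℕ)
    (h : ∀ i ∈ l, C.HL (X ++ [f i]) - C.HL X ≤ x) :
    C.HL (X ++ l.map f) - C.HL X ≤ l.length * x := by
  induction l with
  | nil => simp
  | cons i l ih =>
    have h₁ := ih fun k hk => h k (by simp [hk])
    have h₂ := h i (by simp)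
    have h₃ := HL_add_HL_le (C := C) (X := X ++ [f i]) (Y := X ++ l.map f)
      (J := X ++ (i :: l).map f) (Z := X)
      (det_of_subset (by intro a; simp; tauto)) (det_of_subset (by simp)) (det_of_subset (by simp))
    push_cast [List.length_cons]
    linarith

/-- The exchange inequality: the normalised increments of `H(U^{(t,s)} | M_A)` in `s`
are nonincreasing. -/
lemma exchange (hsym : C.Symmetrical) (hregen : C.NodeRegen) (A : List ℕ) {t s : ℕ}
    (hts : t ≤ s) (hs : s + 2 ≤ d) :
    ((d : ℝ) - s) * (C.HL (U d t (s + 2) ++ MsL A) - C.HL (U d t (s + 1) ++ MsL A)) ≤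
      ((d : ℝ) - s - 1) * (C.HL (U d t (s + 1) ++ MsL A) - C.HL (U d t s ++ MsL A)) := by
  have hM : ∀ u v, ∀ a ∈ MsL A, Atom.perm (Equiv.swap u v) a ∈ MsL A := by
    intro u v a ha
    obtain ⟨i, -, rfl⟩ := mem_MsL.mp ha
    exact ha
  have hX : ∀ u v, s < u → s < v → u ≤ d + 1 → v ≤ d + 1 → ∀ a ∈ U d t s ++ MsL A,
      Atom.perm (Equiv.swap u v) a ∈ U d t s ++ MsL A := by
    intro u v hu hv hud hvd a ha
    rcases List.mem_append.mp ha with ha | ha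
    · exact List.mem_append_left _ (perm_swap_mem_U hts hu hv hud hvd ha)
    · exact List.mem_append_right _ (hM u v a ha)
  set X := U d t s ++ MsL A with hXdef
  have hU₁ : C.HL (U d t (s + 1) ++ MsL A) = C.HL (X ++ SbarTo d (s + 1)) :=
    HL_congr fun a => by
      simp only [hXdef, List.mem_append, mem_U_succ hts]; tauto
  have hle : C.HL (X ++ SbarTo d (s + 1)) - C.HL X ≤
      ((d : ℝ) - s) * (C.HL (X ++ [.S (s + 2) (s + 1)]) - C.HL X) := by
    have := HL_append_map_le (C := C) (X := X) (x := C.HL (X ++ [.S (s + 2) (s + 1)]) - C.HL X)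
      (fun i => Atom.S i (s + 1)) (icc (s + 1 + 1) (d + 1)) (fun i hi => by
        rw [mem_icc] at hi
        have e : Equiv.swap (s + 2) i (s + 1) = s + 1 :=
          Equiv.swap_apply_of_ne_of_ne (by omega) (by omega)
        refine sub_le_sub_right (le_of_eq ?_) _
        refine hsym.HL_eq_of_swap (u := s + 2) (v := i) (Finset.mem_Icc.mpr (by omega))
          (Finset.mem_Icc.mpr (by omega)) ?_ ?_ <;>
        · intro a ha
          rcases List.mem_append.mp ha with ha | ha
          · exact List.mem_append_left _
              (hX _ _ (by omega) (by omega) (by omega) (by omega) a ha)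
          · obtain rfl := List.mem_singleton.mp ha
            simp [Atom.perm, e])
    have hlen : ((icc (s + 1 + 1) (d + 1)).length : ℝ) = (d : ℝ) - s := by
      have : (icc (s + 1 + 1) (d + 1)).length = d - s := by simp [icc]
      rw [this, Nat.cast_sub (by omega)]
    rw [hlen] at this
    exact this
  have hsub : C.HL (U d t (s + 2) ++ MsL A) + C.HL (X ++ [.S (s + 1) (s + 2)]) ≤
      C.HL (U d t (s + 1) ++ MsL A) +
        C.HL (X ++ [.S (s + 1) (s + 2)] ++ SbarTo d (s + 2)) := by
    refine HL_add_HL_le (det_of_subset fun a => ?_) (Det.append ?_ ?_)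
      (det_of_subset (List.subset_append_left _ _))
    · simp only [List.mem_append, mem_U_succ (show t ≤ s + 1 by omega)]
      tauto
    · refine det_of_subset fun a => ?_
      simp only [hXdef, List.mem_append]
      exact Or.imp_left fun h => U_subset_U (Nat.le_succ s) h
    · exact (det_of_subset (List.subset_append_left _ _)).trans
        (hregen.det_U_S (by omega) (by omega) le_rfl (by omega) (by omega) (by omega))
  have hmem : s + 1 ∈ Finset.Icc 1 (d + 1) := Finset.mem_Icc.mpr (by omega)
  have hmem' : s + 2 ∈ Finset.Icc 1 (d + 1) := Finset.mem_Icc.mpr (by omega)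
  have hsw₁ : C.HL (X ++ [.S (s + 1) (s + 2)]) = C.HL (X ++ [.S (s + 2) (s + 1)]) := by
    refine hsym.HL_eq_of_swap hmem hmem' ?_ ?_ <;>
    · intro a ha
      rcases List.mem_append.mp ha with ha | ha
      · exact List.mem_append_left _ (hX _ _ (by omega) (by omega) (by omega) (by omega) a ha)
      · obtain rfl := List.mem_singleton.mp ha
        simp [Atom.perm]
  have hsw₂ : C.HL (X ++ [.S (s + 1) (s + 2)] ++ SbarTo d (s + 2)) =
      C.HL (X ++ SbarTo d (s + 1)) := by
    refine hsym.HL_eq_of_swap hmem hmem' ?_ ?_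
    · intro a ha
      rw [List.append_assoc] at ha
      rcases List.mem_append.mp ha with ha | ha
      · exact List.mem_append_left _ (hX _ _ (by omega) (by omega) (by omega) (by omega) a ha)
      · refine List.mem_append_right _ (mem_SbarTo.mpr ?_)
        rcases List.mem_append.mp ha with ha | ha
        · obtain rfl := List.mem_singleton.mp ha
          exact ⟨s + 2, by omega, by simp [Atom.perm]⟩
        · obtain ⟨i, hi, rfl⟩ := mem_SbarTo.mp ha
          have e : Equiv.swap (s + 1) (s + 2) i = i :=
            Equiv.swap_apply_of_ne_of_ne (by omega) (by omega)
          exact ⟨i, by omega, by simp [Atom.perm, e]⟩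
    · intro a ha
      rw [List.append_assoc]
      rcases List.mem_append.mp ha with ha | ha
      · exact List.mem_append_left _ (hX _ _ (by omega) (by omega) (by omega) (by omega) a ha)
      · refine List.mem_append_right _ ?_
        obtain ⟨i, hi, rfl⟩ := mem_SbarTo.mp ha
        rcases Nat.lt_or_ge (s + 2) i with h | h
        · have e : Equiv.swap (s + 1) (s + 2) i = i :=
            Equiv.swap_apply_of_ne_of_ne (by omega) (by omega)
          exact List.mem_append_right _ (mem_SbarTo.mpr ⟨i, by omega, by simp [Atom.perm, e]⟩)
        · obtain rfl : i = s + 2 := by omega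
          exact List.mem_append_left _ (by simp [Atom.perm])
  have hds : (0 : ℝ) ≤ (d : ℝ) - s := by
    have : (s : ℝ) + 2 ≤ d := by exact_mod_cast hs
    linarith
  rw [hsw₁, hsw₂] at hsub
  rw [hU₁] at hsub ⊢
  have := mul_le_mul_of_nonneg_left (show C.HL (U d t (s + 2) ++ MsL A) -
    C.HL (X ++ SbarTo d (s + 1)) ≤ (C.HL (X ++ SbarTo d (s + 1)) - C.HL X) -
      (C.HL (X ++ [.S (s + 2) (s + 1)]) - C.HL X) by linarith) hds
  linarith

lemma HL_MsL_le (l : List ℕ) : C.HL (MsL l) ≤ (l.map fun i => C.HL [.M i]).sum := by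
  induction l with
  | nil => simp [MsL]
  | cons i l ih =>
    have := HL_append_le (C := C) [.M i] (MsL l)
    simp only [List.map_cons, List.sum_cons]
    have e : MsL (i :: l) = [.M i] ++ MsL l := rfl
    rw [e]
    linarith

lemma HL_singleton (a : Atom) : C.HL [a] = H C.p (C.atomRV a) :=
  le_antisymm (H_mono C.p_nonneg fun ω ω' h => rv_eq_iff.mpr (by simpa using h))
    (H_mono C.p_nonneg fun ω ω' h => by simpa using rv_eq_iff.mp h)

lemma list_sum_icc (f : ℕ → ℝ) (a b : ℕ) : ((icc a b).map f).sum = ∑ i ∈ Finset.Icc a b, f i := by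
  have hn : (icc a b).Nodup := List.nodup_range'
  rw [← List.sum_toFinset f hn]
  congr 1
  ext i
  simp [mem_icc]

/-- The messages being independent, their entropies add up. -/
lemma HL_MsL_all : C.HL (MsL (icc 1 d)) = ∑ i ∈ Finset.Icc 1 d, C.HL [.M i] := by
  have e : C.HL (MsL (icc 1 d)) = H C.p (fun ω (i : Fin d) => C.M (↑i + 1) ω) := by
    refine le_antisymm (H_mono C.p_nonneg fun ω ω' h => ?_) (H_mono C.p_nonneg fun ω ω' h => ?_)
    · refine rv_eq_iff.mpr fun a ha => ?_
      obtain ⟨i, hi, rfl⟩ := mem_MsL.mp ha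
      rw [mem_icc] at hi
      have := congrFun h ⟨i - 1, by omega⟩
      simp only [Nat.sub_add_cancel hi.1] at this
      exact this
    · funext i
      exact rv_eq_iff.mp h _ (mem_MsL.mpr ⟨i + 1, mem_icc.mpr (by omega), rfl⟩)
  rw [e, Finset.sum_congr rfl fun i _ => HL_singleton (C := C) (.M i)]
  unfold H
  rw [Finset.sum_neg_distrib, Finset.sum_comm]
  congr 1
  refine Finset.sum_congr rfl fun ω _ => ?_
  rcases (C.p_nonneg ω).eq_or_lt with h0 | h0
  · simp [← h0]
  rw [← Finset.mul_sum]
  congr 1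
  have := C.M_indep fun i => C.M i ω
  rw [this, Real.log_prod]
  · rfl
  · intro i _
    exact (h0.trans_le (le_pm_self C.p_nonneg (C.M i) ω)).ne'

lemma HL_MsL_icc {a b : ℕ} (ha : 1 ≤ a) (hb : b ≤ d) :
    C.HL (MsL (icc a b)) = ∑ i ∈ Finset.Icc a b, C.HL [.M i] := by
  refine le_antisymm ((HL_MsL_le _).trans_eq (list_sum_icc _ a b)) ?_
  set l := (icc 1 d).filter fun i => i ∉ icc a b with hl
  have h₁ : C.HL (MsL (icc 1 d)) ≤ C.HL (MsL (icc a b)) + C.HL (MsL l) := by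
    refine le_trans (Det.HL_le (det_of_subset fun x hx => ?_)) (HL_append_le _ _)
    obtain ⟨i, hi, rfl⟩ := mem_MsL.mp hx
    by_cases h : i ∈ icc a b
    · exact List.mem_append_left _ (mem_MsL.mpr ⟨i, h, rfl⟩)
    · exact List.mem_append_right _ (mem_MsL.mpr ⟨i, by simp [hl, hi, h], rfl⟩)
  have h₂ : (l.map fun i => C.HL [.M i]).sum =
      ∑ i ∈ Finset.Icc 1 d \ Finset.Icc a b, C.HL [.M i] := by
    have hn : l.Nodup := List.Nodup.filter _ List.nodup_range'
    rw [← List.sum_toFinset _ hn]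
    congr 1
    ext i
    simp only [hl, List.mem_toFinset, List.mem_filter, mem_icc, decide_eq_true_eq,
      Finset.mem_sdiff, Finset.mem_Icc]
  have h₃ := HL_MsL_le (C := C) l
  have h₄ := Finset.sum_sdiff (f := fun i => C.HL [.M i])
    (Finset.Icc_subset_Icc ha hb)
  rw [HL_MsL_all] at h₁
  linarith

/-- Repair secrecy makes `U^{(ℓ₁,ℓ₁+ℓ₂)}` independent of the messages. -/
lemma RepairSecrecy.HL_U {ℓ₁ ℓ₂ m : ℕ} (hsec : C.RepairSecrecy ℓ₁ ℓ₂) (hd : ℓ₁ + ℓ₂ ≤ d)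
    (hm : m ≤ d) :
    C.HL (U d ℓ₁ (ℓ₁ + ℓ₂) ++ MsL (icc (ℓ₁ + ℓ₂ + 1) m)) =
      C.HL (U d ℓ₁ (ℓ₁ + ℓ₂)) + C.HL (MsL (icc (ℓ₁ + ℓ₂ + 1) m)) := by
  refine le_antisymm (HL_append_le _ _) ?_
  set N := MsL (icc (ℓ₁ + ℓ₂ + 1) m)
  set D := MsL (icc (ℓ₁ + ℓ₂ + 1) d)
  have h := hsec (Finset.Icc 1 ℓ₁) (Finset.Icc (ℓ₁ + 1) (ℓ₁ + ℓ₂))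
    (Finset.Icc_subset_Icc le_rfl (by omega)) (Finset.Icc_subset_Icc (by omega) (by omega))
    (Finset.disjoint_left.mpr fun i hi hi' => by
      rw [Finset.mem_Icc] at hi hi'; omega) (by simp) (by simp)
  set R := Ws ((Finset.Icc 1 ℓ₁).sort (· ≤ ·)) ++
    StoFullL d ((Finset.Icc (ℓ₁ + 1) (ℓ₁ + ℓ₂)).sort (· ≤ ·)) with hR
  have hUR : U d ℓ₁ (ℓ₁ + ℓ₂) ⊆ R := by
    intro a ha
    rw [hR, List.mem_append]
    rcases mem_U.mp ha with ⟨i, hi, rfl⟩ | ⟨j, hj, i, hi, rfl⟩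
    · exact .inl (List.mem_map.mpr ⟨i, by simpa using hi, rfl⟩)
    · refine .inr (List.mem_flatten.mpr ⟨_, List.mem_map.mpr ⟨j, by simpa using hj, rfl⟩, ?_⟩)
      refine List.mem_map.mpr ⟨i, ?_, rfl⟩
      simp only [List.mem_filter, mem_icc, decide_eq_true_eq]
      omega
  have hND : N ⊆ D := by
    intro a ha
    obtain ⟨i, hi, rfl⟩ := mem_MsL.mp ha
    rw [mem_icc] at hi
    exact mem_MsL.mpr ⟨i, mem_icc.mpr (by omega), rfl⟩
  have h₁ : C.HL (D ++ R) + C.HL (U d ℓ₁ (ℓ₁ + ℓ₂)) ≤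
      C.HL (U d ℓ₁ (ℓ₁ + ℓ₂) ++ D) + C.HL R :=
    HL_add_HL_le (det_of_subset fun a => by simp only [List.mem_append]; tauto)
      (det_of_subset (List.subset_append_left _ _)) (det_of_subset hUR)
  have h₂ : C.HL (U d ℓ₁ (ℓ₁ + ℓ₂) ++ D) + C.HL N ≤ C.HL (U d ℓ₁ (ℓ₁ + ℓ₂) ++ N) + C.HL D :=
    HL_add_HL_le (det_of_subset fun a => by simp only [List.mem_append]; tauto)
      (det_of_subset (List.subset_append_right _ _)) (det_of_subset hND)
  unfold MI at h
  linarith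

end Code

lemma T_succ {d k ℓ : ℕ} (h : ℓ ≤ k) : T d (k + 1) ℓ = T d k ℓ + ((d : ℝ) - k) := by
  unfold T
  rw [Finset.sum_Icc_succ_top (by omega)]
  push_cast
  ring

lemma T_self (d ℓ : ℕ) : T d ℓ ℓ = 0 := by simp [T]

lemma T_nonneg {d k ℓ : ℕ} (hk : k ≤ d) : 0 ≤ T d k ℓ := by
  refine Finset.sum_nonneg fun t ht => ?_
  have : (t : ℝ) ≤ d := by exact_mod_cast (Finset.mem_Icc.mp ht).2.trans hk
  linarith

/-- A sequence whose increments, normalised by `d, d - 1, …`, are nonincreasing has its next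
normalised increment bounded by the average of the previous ones. -/
lemma T_mul_increment_le {d ℓ : ℕ} {g : ℕ → ℝ}
    (hg : ∀ t, ℓ ≤ t → t + 2 ≤ d →
      ((d : ℝ) - t) * (g (t + 2) - g (t + 1)) ≤ ((d : ℝ) - t - 1) * (g (t + 1) - g t))
    {k : ℕ} (hk : ℓ ≤ k) (hkd : k + 1 ≤ d) :
    T d k ℓ * (g (k + 1) - g k) ≤ ((d : ℝ) - k) * (g k - g ℓ) := by
  induction k, hk using Nat.le_induction with
  | base => simp [T_self]
  | succ k hk ih =>
    have ih := ih (by omega)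
    have h := hg k hk hkd
    have hT := T_nonneg (ℓ := ℓ) (show k ≤ d by omega)
    have ha : (k : ℝ) + 2 ≤ d := by exact_mod_cast hkd
    rw [T_succ hk]
    push_cast
    have h₁ : T d k ℓ * (g (k + 2) - g (k + 1)) ≤ ((d : ℝ) - k - 1) * (g k - g ℓ) := by
      refine le_of_mul_le_mul_left ?_ (show (0 : ℝ) < (d : ℝ) - k by linarith)
      have h₂ := mul_le_mul_of_nonneg_left h hT
      have h₃ := mul_le_mul_of_nonneg_left ih (show (0 : ℝ) ≤ (d : ℝ) - k - 1 by linarith)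
      linarith
    linarith

theorem statement11 {Ω V : Type} [Fintype Ω] {d : ℕ} (hd : 2 ≤ d)
    {ℓ₁ ℓ₂ ℓ : ℕ} (hℓdef : ℓ = ℓ₁ + ℓ₂) (hℓd : ℓ < d)
    (C : Code Ω V d) (hsym : C.Symmetrical) (hregen : C.NodeRegen)
    (hrec : C.MsgRecovery ℓ) (hsec : C.RepairSecrecy ℓ₁ ℓ₂) :
    1 / ((d : ℝ) - (ℓ : ℝ)) * C.HL (U d ℓ₁ (ℓ + 1))
      ≥ (∑ j ∈ Finset.Icc (ℓ + 1) d, (T d j ℓ)⁻¹ * C.HL [Atom.M j])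
        + 1 / ((d : ℝ) - (ℓ : ℝ)) * C.HL (U d ℓ₁ ℓ) := by
  subst hℓdef
  set ℓ := ℓ₁ + ℓ₂ with hℓ
  set h : ℕ → ℕ → ℝ := fun s m => C.HL (U d ℓ₁ s ++ MsL (icc (ℓ + 1) m)) with hh
  have hnext : ∀ m, ℓ ≤ m → m + 1 ≤ d →
      h (m + 1) (m + 1) - h ℓ (m + 1) + C.HL [Atom.M (m + 1)] ≤ h (m + 1) m - h ℓ m := by
    intro m hm hmd
    have h₁ : h (m + 1) (m + 1) ≤ h (m + 1) m := by
      refine Code.Det.HL_le (Code.Det.append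
        (Code.det_of_subset (List.subset_append_left _ _)) fun ω ω' hω a ha => ?_)
      obtain ⟨i, hi, rfl⟩ := mem_MsL.mp ha
      rw [mem_icc] at hi
      rcases Nat.lt_or_ge m i with hmi | hmi
      · obtain rfl : i = m + 1 := by omega
        exact hrec.det_U_M hregen (by omega) hmd ω ω'
          (fun a ha => hω a (List.mem_append_left _ ha)) _ (List.mem_singleton.mpr rfl)
      · exact hω _ (List.mem_append_right _ (mem_MsL.mpr ⟨i, mem_icc.mpr ⟨hi.1, hmi⟩, rfl⟩))
    have h₂ : h ℓ m = _ := hsec.HL_U hℓd.le (by omega)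
    have h₃ : h ℓ (m + 1) = _ := hsec.HL_U hℓd.le hmd
    rw [Code.HL_MsL_icc (by omega) (by omega)] at h₂ h₃
    rw [Finset.sum_Icc_succ_top (by omega)] at h₃
    linarith
  have hstart : ∀ s, C.HL (U d ℓ₁ s) = h s ℓ := by
    intro s
    simp [hh, icc, MsL]
  have hTpos : ∀ m, ℓ ≤ m → m + 1 ≤ d → 0 < T d (m + 1) ℓ := by
    intro m hm hmd
    have := T_nonneg (ℓ := ℓ) (show m ≤ d by omega)
    have : (m : ℝ) + 1 ≤ d := by exact_mod_cast hmd
    rw [T_succ hm]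
    linarith
  have hT₁ : T d (ℓ + 1) ℓ = (d : ℝ) - ℓ := by rw [T_succ le_rfl, T_self, zero_add]
  have chain : ∀ m, ℓ + 1 ≤ m → m ≤ d →
      (∑ j ∈ Finset.Icc (ℓ + 1) m, (T d j ℓ)⁻¹ * C.HL [Atom.M j]) +
        (T d m ℓ)⁻¹ * (h m m - h ℓ m) ≤ (T d (ℓ + 1) ℓ)⁻¹ * (h (ℓ + 1) ℓ - h ℓ ℓ) := by
    intro m hm
    induction m, hm using Nat.le_induction with
    | base =>
      intro hmd
      rw [Finset.Icc_self, Finset.sum_singleton, ← mul_add]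
      refine mul_le_mul_of_nonneg_left ?_ (inv_nonneg.mpr (hTpos ℓ le_rfl hmd).le)
      linarith [hnext ℓ le_rfl hmd]
    | succ m hm ih =>
      intro hmd
      have hT := hTpos m (by omega) hmd
      have hT' : 0 < T d m ℓ := by
        obtain ⟨k, rfl⟩ : ∃ k, m = k + 1 := ⟨m - 1, by omega⟩
        exact hTpos k (by omega) (by omega)
      have hinc := T_mul_increment_le (g := fun s => h s m)
        (fun t ht htd => Code.exchange hsym hregen _ (by omega) htd)
        (show ℓ ≤ m by omega) hmd
      have havg : (T d (m + 1) ℓ)⁻¹ * (h (m + 1) m - h ℓ m) ≤ (T d m ℓ)⁻¹ * (h m m - h ℓ m) := by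
        rw [inv_mul_eq_div, inv_mul_eq_div, div_le_div_iff₀ hT hT', T_succ (by omega)]
        linarith
      have hn := mul_le_mul_of_nonneg_left (hnext m (by omega) hmd) (inv_nonneg.mpr hT.le)
      rw [Finset.sum_Icc_succ_top (by omega)]
      linarith [ih (by omega)]
  have hfin := chain d hℓd le_rfl
  have hend : 0 ≤ (T d d ℓ)⁻¹ * (h d d - h ℓ d) := by
    refine mul_nonneg (inv_nonneg.mpr (T_nonneg le_rfl)) (sub_nonneg.mpr (Code.Det.HL_le ?_))
    refine Code.det_of_subset fun a => ?_
    simp only [List.mem_append]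
    exact Or.imp_left fun ha => U_subset_U hℓd.le ha
  rw [hT₁] at hfin
  rw [hstart, hstart, one_div]
  linarith

end

end MDCSR
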